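/- Let G be a finite simple graph with a maximum matching M, let v be a vertex of G that is not a star vertex relative to M, and let u be an isolated vertex of G. If G' is the graph obtained from G by deleting all edges incident to v and then adding the edge {u,v}, then ν(G') = ν(G). -/

import Mathlib

open SimpleGraph

/-- `M` is a matching of `G`: a set of edges of `G` that are pairwise vertex-disjoint. -/
def IsMatchingSet {V : Type} (G : SimpleGraph V) (M : Set (Sym2 V)) : Prop :=
  M ⊆ G.edgeSet ∧ M.Pairwise fun e f => ∀ v : V, v ∈ e → v ∉ f

/-- The matching number `ν(G)`: the maximum size of a matching in `G`. -/
noncomputable def nu {V : Type} (G : SimpleGraph V) : ℕ :=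
  sSup {n | ∃ M : Set (Sym2 V), IsMatchingSet G M ∧ M.ncard = n}

/-- `v` is saturated (covered) by the matching `M`. -/
def MSaturates {V : Type} (M : Set (Sym2 V)) (v : V) : Prop := ∃ e ∈ M, v ∈ e

/-- The edges of the walk `p` alternate: the `i`-th edge belongs to `M` iff `i` is odd
(so the walk starts with a non-matching edge). -/
def IsAlternating {V : Type} (M : Set (Sym2 V)) {G : SimpleGraph V} {a b : V}
    (p : G.Walk a b) : Prop :=
  ∀ (i : ℕ) (h : i < p.edges.length), (p.edges[i]'h ∈ M ↔ Odd i)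

/-- A star path of `G` relative to `M`: a path of even length, alternating starting with a
non-matching edge, whose initial vertex is `M`-unsaturated. -/
def IsStarPath {V : Type} (M : Set (Sym2 V)) {G : SimpleGraph V} {a b : V}
    (p : G.Walk a b) : Prop :=
  p.IsPath ∧ Even p.length ∧ ¬ MSaturates M a ∧ IsAlternating M p

/-- `v` is a star vertex of `G` relative to `M`: some star path terminates at `v`. -/
def IsStarVertex {V : Type} (G : SimpleGraph V) (M : Set (Sym2 V)) (v : V) : Prop :=
  ∃ a : V, ∃ p : G.Walk a v, IsStarPath M p

/-- An `M`-augmenting path: a path of odd length, alternating starting and ending with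
non-matching edges, both of whose endpoints are `M`-unsaturated. -/
def IsAugPath {V : Type} (M : Set (Sym2 V)) {G : SimpleGraph V} {a b : V}
    (p : G.Walk a b) : Prop :=
  p.IsPath ∧ Odd p.length ∧ ¬ MSaturates M a ∧ ¬ MSaturates M b ∧ IsAlternating M p

/-- `G ∈ F(d,m)`: `G` is a finite simple graph with maximum degree `< d` and matching
number `< m`, edge-maximal with this property among all finite graphs on vertex sets
containing `V(G)`. -/
def MemF (d m : ℕ) {V : Type} [Fintype V] (G : SimpleGraph V) : Prop :=
  (∀ v : V, (G.neighborSet v).ncard < d) ∧ nu G < m ∧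
  ∀ (W : Type) [Fintype W] (f : V ↪ W) (G' : SimpleGraph W),
    (∀ u v : V, G.Adj u v → G'.Adj (f u) (f v)) →
    G.edgeSet.ncard < G'.edgeSet.ncard →
    (∃ w : W, d ≤ (G'.neighborSet w).ncard) ∨ m ≤ nu G'

namespace IsMatchingSet

variable {V : Type} {G : SimpleGraph V} {M N : Set (Sym2 V)}

theorem eq_of_mem (hM : IsMatchingSet G M) {e f : Sym2 V} (he : e ∈ M) (hf : f ∈ M) {z : V}
    (hze : z ∈ e) (hzf : z ∈ f) : e = f := by
  by_contra hne
  exact hM.2 he hf hne z hze hzf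

theorem mono (hM : IsMatchingSet G M) (h : N ⊆ M) : IsMatchingSet G N :=
  ⟨h.trans hM.1, hM.2.mono h⟩

theorem not_saturates_diff (hM : IsMatchingSet G M) {e : Sym2 V} (he : e ∈ M) {z : V}
    (hz : z ∈ e) : ¬ MSaturates (M \ {e}) z := by
  rintro ⟨f, ⟨hf, hne⟩, hzf⟩
  exact hne (hM.eq_of_mem hf he hzf hz)

theorem insert (hM : IsMatchingSet G M) {e : Sym2 V} (he : e ∈ G.edgeSet)
    (h : ∀ z ∈ e, ¬ MSaturates M z) : IsMatchingSet G (insert e M) := by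
  refine ⟨Set.insert_subset he hM.1, ?_⟩
  rintro f (rfl | hf) g (rfl | hg) hne z hzf hzg
  · exact hne rfl
  · exact h z hzf ⟨g, hg, hzg⟩
  · exact h z hzg ⟨f, hf, hzf⟩
  · exact hM.2 hf hg hne z hzf hzg

theorem ncard_le_nu [Finite V] (hM : IsMatchingSet G M) : M.ncard ≤ nu G := by
  refine le_csSup ⟨Nat.card (Sym2 V), ?_⟩ ⟨M, hM, rfl⟩
  rintro _ ⟨N, -, rfl⟩
  exact Set.ncard_le_card N

end IsMatchingSet

theorem MSaturates.mono {V : Type} {M N : Set (Sym2 V)} {z : V} (h : MSaturates M z)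
    (hMN : M ⊆ N) : MSaturates N z := by
  obtain ⟨e, he, hz⟩ := h
  exact ⟨e, hMN he, hz⟩

theorem nu_le {V : Type} {G : SimpleGraph V} {n : ℕ}
    (h : ∀ N : Set (Sym2 V), IsMatchingSet G N → N.ncard ≤ n) : nu G ≤ n := by
  refine csSup_le ⟨0, ∅, ⟨Set.empty_subset _, Set.pairwise_empty _⟩, Set.ncard_empty _⟩ ?_
  rintro _ ⟨N, hN, rfl⟩
  exact h N hN

theorem IsStarPath.concat_concat {V : Type} {G : SimpleGraph V} {M : Set (Sym2 V)} {a x w v : V}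
    {p : G.Walk a x} (hp : IsStarPath M p) (hxw : G.Adj x w) (hwv : G.Adj w v)
    (hxwM : s(x, w) ∉ M) (hwvM : s(w, v) ∈ M) (hw : w ∉ p.support) (hv : v ∉ p.support) :
    IsStarPath M ((p.concat hxw).concat hwv) := by
  obtain ⟨hpath, heven, ha, halt⟩ := hp
  refine ⟨?_, ?_, ha, ?_⟩
  · refine (hpath.concat hw hxw).concat ?_ hwv
    simp [Walk.support_concat, hv, hwv.ne']
  · simp only [Walk.length_concat]
    grind
  · intro i hi
    have hlen : p.edges.length = p.length := p.length_edges
    simp only [Walk.edges_concat, List.concat_eq_append, List.length_append,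
      List.length_singleton] at hi
    simp only [Walk.edges_concat, List.concat_eq_append, List.append_assoc]
    rcases lt_or_ge i p.edges.length with h | h
    · rw [List.getElem_append_left h]
      exact halt i h
    · rw [List.getElem_append_right h]
      obtain h' | h' : i = p.edges.length ∨ i = p.edges.length + 1 := by omega
      · subst h'
        simp [hxwM, hlen, heven]
      · subst h'
        simp [hwvM, heven.add_one]

/-- A vertex missed by a maximum matching `N` is a star vertex relative to `M`, through a star
path all of whose vertices, except possibly the last, lie on edges of `N \ M`. -/
theorem exists_isStarPath_of_not_saturates {V : Type} [Finite V] {G : SimpleGraph V}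
    {M : Set (Sym2 V)} (hM : IsMatchingSet G M) (N : Set (Sym2 V)) (hN : IsMatchingSet G N)
    (hNmax : N.ncard = nu G) (v : V) (hv : ¬ MSaturates N v) :
    ∃ (a : V) (p : G.Walk a v), IsStarPath M p ∧
      ∀ z ∈ p.support, z ≠ v → MSaturates (N \ M) z := by
  induction hn : (M \ N).ncard using Nat.strong_induction_on generalizing N v with
  | _ n ih =>
  by_cases hvM : MSaturates M v
  swap
  · exact ⟨v, Walk.nil, ⟨by simp, by simp, hvM, by intro i hi; simp at hi⟩, by simp⟩
  obtain ⟨e, he, hve⟩ := hvM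
  obtain ⟨w, rfl⟩ := Sym2.mem_iff_exists.1 hve
  have hvw : G.Adj v w := hM.1 he
  have heN : s(v, w) ∉ N := fun h => hv ⟨_, h, hve⟩
  by_cases hwN : MSaturates N w
  swap
  · have hins := (hN.insert (e := s(v, w)) hvw (by
      intro z hz
      rcases Sym2.mem_iff.1 hz with rfl | rfl <;> assumption)).ncard_le_nu
    rw [Set.ncard_insert_of_notMem heN (Set.toFinite _)] at hins
    omega
  obtain ⟨f, hf, hwf⟩ := hwN
  obtain ⟨x, rfl⟩ := Sym2.mem_iff_exists.1 hwf
  have hwx : G.Adj w x := hN.1 hf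
  have hxv : x ≠ v := by
    rintro rfl
    exact hv ⟨_, hf, by simp⟩
  have hfM : s(w, x) ∉ M := by
    intro h
    have := hM.eq_of_mem he h (z := w) (by simp) (by simp)
    rw [this] at hve
    rcases Sym2.mem_iff.1 hve with h | h
    · exact hvw.ne h
    · exact hxv h.symm
  set N₂ := insert s(v, w) (N \ {s(w, x)}) with hN₂def
  have hN₂ : IsMatchingSet G N₂ := by
    refine (hN.mono Set.sdiff_subset).insert hvw ?_
    intro z hz
    rcases Sym2.mem_iff.1 hz with rfl | rfl
    · exact fun h => hv (h.mono Set.sdiff_subset)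
    · exact hN.not_saturates_diff hf (by simp)
  have hN₂card : N₂.ncard = nu G := by
    rw [hN₂def, Set.ncard_insert_of_notMem (fun h => heN h.1) (Set.toFinite _),
      Set.ncard_sdiff_singleton_add_one hf (Set.toFinite _), hNmax]
  have hx : ¬ MSaturates N₂ x := by
    rintro ⟨g, rfl | hg, hxg⟩
    · rcases Sym2.mem_iff.1 hxg with h | h
      · exact hxv h
      · exact hwx.ne h.symm
    · exact hN.not_saturates_diff hf (z := x) (by simp) ⟨g, hg, hxg⟩
  have hlt : (M \ N₂).ncard < n := by
    rw [← hn]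
    refine Set.ncard_lt_ncard ⟨?_, fun h => (h ⟨he, heN⟩).2 (Set.mem_insert _ _)⟩ (Set.toFinite _)
    rintro g ⟨hgM, hgN⟩
    refine ⟨hgM, fun h => hgN (Or.inr ⟨h, ?_⟩)⟩
    rintro rfl
    exact hfM hgM
  obtain ⟨a, p, hp, hsupp⟩ := ih _ hlt N₂ hN₂ hN₂card x hx rfl
  have hunsat : ∀ z ∈ s(v, w), ¬ MSaturates (N₂ \ M) z := by
    rintro z hz ⟨g, ⟨hg, hgM⟩, hzg⟩
    exact hgM (hN₂.eq_of_mem hg (Set.mem_insert _ _) hzg hz ▸ he)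
  have hwp : w ∉ p.support := fun h => hunsat w (by simp) (hsupp w h hwx.ne)
  have hvp : v ∉ p.support := fun h => hunsat v (by simp) (hsupp v h hxv.symm)
  refine ⟨a, _, hp.concat_concat hwx.symm hvw.symm (by rwa [Sym2.eq_swap])
    (by rwa [Sym2.eq_swap]) hwp hvp, ?_⟩
  intro z hz hzv
  have hz' : z ∈ p.support ∨ z = w := by
    simpa [Walk.support_concat, hzv] using hz
  by_cases hzwx : z ∈ s(w, x)
  · exact ⟨_, ⟨hf, hfM⟩, hzwx⟩
  · obtain ⟨hzw, hzx⟩ : z ≠ w ∧ z ≠ x := by simpa using hzwx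
    obtain ⟨g, ⟨rfl | hg, hgM⟩, hzg⟩ := hsupp z (hz'.resolve_right hzw) hzx
    · exact absurd he hgM
    · exact ⟨g, ⟨hg.1, hgM⟩, hzg⟩

/-- deleting all edges at a non-star vertex `v` and joining `v` to an
isolated vertex `u` preserves the matching number. -/
theorem stmt_8 {V : Type} [Fintype V] (G : SimpleGraph V) (M : Set (Sym2 V))
    (hM : IsMatchingSet G M) (hmax : M.ncard = nu G)
    (v u : V) (hv : ¬ IsStarVertex G M v) (hu : ∀ w : V, ¬ G.Adj u w)
    (G' : SimpleGraph V)
    (hG' : G' = (G.deleteEdges {e : Sym2 V | v ∈ e}) ⊔ SimpleGraph.fromEdgeSet {s(u, v)}) :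
    nu G' = nu G := by
  have hmem : ∀ e, e ∈ G'.edgeSet ↔ (e ∈ G.edgeSet ∧ v ∉ e) ∨ (e = s(u, v) ∧ ¬ e.IsDiag) := by
    intro e
    simp [hG', SimpleGraph.edgeSet_sup, SimpleGraph.edgeSet_deleteEdges]
  have huM : ∀ e ∈ G.edgeSet, u ∉ e := by
    intro e he hue
    obtain ⟨w, rfl⟩ := Sym2.mem_iff_exists.1 hue
    exact hu w he
  apply le_antisymm
  · refine nu_le fun N hN => ?_
    have hsub : ∀ e ∈ N \ {s(u, v)}, e ∈ G.edgeSet ∧ v ∉ e := by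
      rintro e ⟨he, hne⟩
      exact ((hmem e).1 (hN.1 he)).resolve_right fun h => hne h.1
    have hN₀ : IsMatchingSet G (N \ {s(u, v)}) :=
      ⟨fun e he => (hsub e he).1, hN.2.mono Set.sdiff_subset⟩
    have hle := hN₀.ncard_le_nu
    by_contra! hlt
    have hcard := Set.ncard_le_ncard_sdiff_add_ncard N {s(u, v)} (Set.toFinite _)
    rw [Set.ncard_singleton] at hcard
    obtain ⟨a, p, hp, -⟩ := exists_isStarPath_of_not_saturates hM _ hN₀ (by omega) v
      (fun ⟨e, he, hve⟩ => (hsub e he).2 hve)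
    exact hv ⟨a, p, hp⟩
  · by_cases hvM : MSaturates M v
    swap
    · exact absurd ⟨v, Walk.nil, by simp, by simp, hvM, by intro i hi; simp at hi⟩ hv
    obtain ⟨e, he, hve⟩ := hvM
    have huv : u ≠ v := by
      rintro rfl
      exact huM e (hM.1 he) hve
    have hN₀ : IsMatchingSet G' (M \ {e}) := by
      refine ⟨fun f hf => (hmem f).2 (Or.inl ⟨hM.1 hf.1, fun hvf => ?_⟩),
        hM.2.mono Set.sdiff_subset⟩
      exact hM.not_saturates_diff he hve ⟨f, hf, hvf⟩
    have huvM : s(u, v) ∉ M \ {e} := fun h => huM _ (hM.1 h.1) (by simp)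
    have hins : IsMatchingSet G' (insert s(u, v) (M \ {e})) := by
      refine hN₀.insert ((hmem _).2 (Or.inr ⟨rfl, by simpa using huv⟩)) ?_
      intro z hz
      rcases Sym2.mem_iff.1 hz with rfl | rfl
      · rintro ⟨f, hf, hzf⟩
        exact huM f (hM.1 hf.1) hzf
      · exact hM.not_saturates_diff he hve
    have hle := hins.ncard_le_nu
    rwa [Set.ncard_insert_of_notMem huvM (Set.toFinite _),
      Set.ncard_sdiff_singleton_add_one he (Set.toFinite _), hmax] at hle
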